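/- arXiv:2207.02898 — 6 statements merged into one kernel-verified Lean document; each statement's English description precedes it below -/
import Mathlib

section
/- Let b > a > 0, u_L < 0 < u_H, and 0 < c < −b·u_L. Define the likelihood ratio cutoff L̄ = (−u_L − c/b)/(c/b), the belief p̄ = L̄/(1+L̄), the constant K = (c/b)·(b/a − 1)·L̄^{−a/(b−a)}, the function V(p) = p(u_H − c/a) − (1−p)(c/b) + K·p^{b/(b−a)}(1−p)^{−a/(b−a)} on (0,1), and the linear function U_R(p) = p·u_H + (1−p)·u_L. Then L̄ > 0, K > 0, and value matching and smooth pasting hold at p̄: V(p̄) = U_R(p̄) and V′(p̄) = U_R′(p̄). -/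
open Real Set Filter Topology

/-- Value matching and smooth pasting at the upper learning boundary `p̄` in the single
decision maker benchmark, together with positivity of the cutoff likelihood ratio `L̄`
and of the integration constant `K`. -/
theorem stmt3 (a b c uH uL : ℝ) (ha : 0 < a) (hab : a < b)
    (huL : uL < 0) (huH : 0 < uH) (hc : 0 < c) (hc' : c < -b * uL)
    (Lbar : ℝ) (hLbar : Lbar = (-uL - c / b) / (c / b))
    (pbar : ℝ) (hpbar : pbar = Lbar / (1 + Lbar))
    (K : ℝ) (hK : K = (c / b) * (b / a - 1) * Lbar ^ (-a / (b - a)))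
    (V UR : ℝ → ℝ)
    (hV : ∀ p : ℝ, V p = p * (uH - c / a) - (1 - p) * (c / b)
        + K * p ^ (b / (b - a)) * (1 - p) ^ (-a / (b - a)))
    (hUR : ∀ p : ℝ, UR p = p * uH + (1 - p) * uL) :
    0 < Lbar ∧ 0 < K ∧ V pbar = UR pbar ∧ deriv V pbar = deriv UR pbar := by
  have hb : 0 < b := ha.trans hab
  have hd : 0 < b - a := sub_pos.mpr hab
  have hcb : 0 < c / b := div_pos hc hb
  have hnum : 0 < -uL - c / b := by
    have : c / b < -uL := by
      rw [div_lt_iff₀ hb]; linarith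
    linarith
  have hL : 0 < Lbar := by rw [hLbar]; exact div_pos hnum hcb
  have hba : 0 < b / a - 1 := by
    have : 1 < b / a := by rw [lt_div_iff₀ ha]; linarith
    linarith
  have hKpos : 0 < K := by
    rw [hK]
    exact mul_pos (mul_pos hcb hba) (Real.rpow_pos_of_pos hL _)
  have hLc : (1 + Lbar) * (c / b) = -uL := by
    rw [hLbar, add_mul, div_mul_cancel₀ _ hcb.ne']; ring
  have h1L : 0 < 1 + Lbar := by linarith
  have hp : 0 < pbar := by rw [hpbar]; exact div_pos hL h1L
  have hq1 : 1 - pbar = 1 / (1 + Lbar) := by rw [hpbar]; field_simp; ring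
  have hq : 0 < 1 - pbar := by rw [hq1]; exact div_pos one_pos h1L
  have hLpq : Lbar = pbar / (1 - pbar) := by rw [hq1, hpbar]; field_simp
  have huLq : (1 - pbar) * uL = -(c / b) := by
    have : uL = -((1 + Lbar) * (c / b)) := by linarith
    rw [hq1, this]; field_simp
  have hα : b / (b - a) = 1 + a / (b - a) := by field_simp; ring
  have hβ : -a / (b - a) = -(a / (b - a)) := by ring
  have hX : K * pbar ^ (b / (b - a)) * (1 - pbar) ^ (-a / (b - a))
      = (c / b) * (b / a - 1) * pbar := by
    rw [hK, hα, hβ, hLpq, Real.rpow_add hp, Real.rpow_one, Real.rpow_neg (div_pos hp hq).le,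
      Real.rpow_neg hq.le, Real.div_rpow hp.le hq.le]
    have h1 := (Real.rpow_pos_of_pos hp (a / (b - a))).ne'
    have h2 := (Real.rpow_pos_of_pos hq (a / (b - a))).ne'
    generalize pbar ^ (a / (b - a)) = x at *
    generalize (1 - pbar) ^ (a / (b - a)) = y at *
    field_simp
  refine ⟨hL, hKpos, ?_, ?_⟩
  · rw [hV, hUR, hX, huLq]
    field_simp
    ring
  · have hVf : V = fun p => p * (uH - c / a) - (1 - p) * (c / b)
        + K * p ^ (b / (b - a)) * (1 - p) ^ (-a / (b - a)) := funext hV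
    have hUf : UR = fun p => p * uH + (1 - p) * uL := funext hUR
    have hid := hasDerivAt_id' pbar
    have hs : HasDerivAt (fun p : ℝ => 1 - p) (-1) pbar := by
      simpa using hid.const_sub 1
    have hU' : HasDerivAt UR (1 * uH + (-1) * uL) pbar := by
      rw [hUf]
      exact (hid.mul_const uH).add (hs.mul_const uL)
    have hP := (hid.rpow_const (p := b / (b - a)) (Or.inl hp.ne')).const_mul K
    have hQ := hs.rpow_const (p := -a / (b - a)) (Or.inl hq.ne')
    have hV' := ((hid.mul_const (uH - c / a)).sub (hs.mul_const (c / b))).add (hP.mul hQ)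
    have hV2 : HasDerivAt V (1 * (uH - c / a) - -1 * (c / b) +
        (K * (1 * (b / (b - a)) * pbar ^ (b / (b - a) - 1)) * (1 - pbar) ^ (-a / (b - a)) +
          K * pbar ^ (b / (b - a))
            * (-1 * (-a / (b - a)) * (1 - pbar) ^ (-a / (b - a) - 1)))) pbar := by
      rw [hVf]
      exact hV'
    rw [hV2.deriv, hU'.deriv, Real.rpow_sub_one hp.ne', Real.rpow_sub_one hq.ne']
    have huL2 : uL = -(c / b) / (1 - pbar) := by
      rw [← huLq]; field_simp
    have key : K * (1 * (b / (b - a)) * (pbar ^ (b / (b - a)) / pbar))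
          * (1 - pbar) ^ (-a / (b - a))
        + K * pbar ^ (b / (b - a))
          * (-1 * (-a / (b - a)) * ((1 - pbar) ^ (-a / (b - a)) / (1 - pbar)))
        = (K * pbar ^ (b / (b - a)) * (1 - pbar) ^ (-a / (b - a)))
          * (b / (b - a) / pbar + a / (b - a) / (1 - pbar)) := by
      ring
    rw [key, hX, huL2]
    field_simp
    ring
end

section
/- Let b > a > 0, u_L < 0 < u_H, and 0 < c < −b·u_L. With L̄ = (−u_L − c/b)/(c/b), p̄ = L̄/(1+L̄), K = (c/b)(b/a − 1)·L̄^{−a/(b−a)}, V(p) = p(u_H − c/a) − (1−p)(c/b) + K·p^{b/(b−a)}(1−p)^{−a/(b−a)}, and U_R(p) = p·u_H + (1−p)·u_L, it holds that V(p) ≥ U_R(p) for every p ∈ (0,1). -/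
open Real Set Filter Topology

/-- In the single decision maker benchmark, the candidate value function of learning
dominates the payoff from immediately taking the risky action at every belief. -/
theorem stmt5 (a b c uH uL : ℝ) (ha : 0 < a) (hab : a < b)
    (huL : uL < 0) (huH : 0 < uH) (hc : 0 < c) (hc' : c < -b * uL)
    (Lbar : ℝ) (hLbar : Lbar = (-uL - c / b) / (c / b))
    (pbar : ℝ) (hpbar : pbar = Lbar / (1 + Lbar))
    (K : ℝ) (hK : K = (c / b) * (b / a - 1) * Lbar ^ (-a / (b - a)))
    (V UR : ℝ → ℝ)
    (hV : ∀ p : ℝ, V p = p * (uH - c / a) - (1 - p) * (c / b)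
        + K * p ^ (b / (b - a)) * (1 - p) ^ (-a / (b - a)))
    (hUR : ∀ p : ℝ, UR p = p * uH + (1 - p) * uL) :
    ∀ p ∈ Set.Ioo (0:ℝ) 1, UR p ≤ V p := by
  rintro p ⟨hp0, hp1⟩
  have hb : 0 < b := ha.trans hab
  have hd : 0 < b - a := sub_pos.2 hab
  have hq : 0 < 1 - p := sub_pos.2 hp1
  have hL : 0 < Lbar := by
    rw [hLbar]
    apply div_pos _ (div_pos hc hb)
    rw [sub_pos, div_lt_iff₀ hb]
    linarith
  have huL' : uL = -(c / b) * (1 + Lbar) := by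
    rw [hLbar]
    field_simp
    ring
  obtain ⟨s, hs⟩ : ∃ s, s = a / (b - a) := ⟨_, rfl⟩
  have hs0 : 0 < s := by rw [hs]; positivity
  have e1 : -a / (b - a) = -s := by rw [hs]; ring
  have e2 : b / (b - a) = 1 + s := by rw [hs]; field_simp; ring
  have e3 : b / a - 1 = 1 / s := by rw [hs]; field_simp
  have e4 : c / a = (c / b) * (1 + 1 / s) := by
    rw [← e3]; field_simp; ring
  have hx : 0 < p / ((1 - p) * Lbar) := by positivity
  have key : Lbar ^ (-s) * p ^ (1 + s) * (1 - p) ^ (-s)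
      = Lbar * (1 - p) * (p / ((1 - p) * Lbar)) ^ (1 + s) := by
    rw [Real.div_rpow hp0.le (by positivity), Real.mul_rpow hq.le hL.le,
      Real.rpow_neg hL.le, Real.rpow_neg hq.le, Real.rpow_add hq, Real.rpow_add hL,
      Real.rpow_one, Real.rpow_one]
    have h1 := Real.rpow_pos_of_pos hL s
    have h2 := Real.rpow_pos_of_pos hq s
    field_simp
  have bern := one_add_mul_self_le_rpow_one_add (s := p / ((1 - p) * Lbar) - 1)
    (by linarith) (p := 1 + s) (by linarith)
  rw [add_sub_cancel] at bern
  have h3 := mul_le_mul_of_nonneg_left bern (mul_pos hL hq).le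
  rw [← key] at h3
  have h4 : Lbar * (1 - p) * (1 + (1 + s) * (p / ((1 - p) * Lbar) - 1))
      = (1 + s) * p - s * (Lbar * (1 - p)) := by
    field_simp
    ring
  rw [h4] at h3
  have hcs : 0 ≤ c / b * (1 / s) := by positivity
  have h5 := mul_le_mul_of_nonneg_left h3 hcs
  rw [hV, hUR, hK, e1, e2, e3, e4, huL']
  have h6 : c / b * (1 / s) * ((1 + s) * p - s * (Lbar * (1 - p)))
      = c / b * (1 + 1 / s) * p - c / b * (Lbar * (1 - p)) := by
    field_simp
    ring
  rw [h6] at h5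
  linarith
end

section
/- Let b > a > 0, c > 0, u_L < 0, ▵̄_H > 0, ▵̄_L > 0, L₀ > 0, and set L(t) = L₀·e^{(b−a)t}. Then there exists exactly one continuously differentiable function ρ : [0,∞) → ℝ with ρ(0) = 0 satisfying, for all t ≥ 0, the integro-differential equation ρ′(t) = (b·(−u_L) − c − L(t)·c + b·▵̄_L·∫₀ᵗ e^{−bs}ρ′(s) ds − L(t)·▵̄_H·a·e^{−at}·(1 − ρ(t))) / (L(t)·▵̄_H·e^{−at} + ▵̄_L·e^{−bt}). -/
open Real Set Filter Topology

/-- Global solvability of the integral equation `V t = ∫₀ᵗ f s (V s)` by a weighted contraction. -/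
lemma volterra_exists {E : Type*} [NormedAddCommGroup E] [NormedSpace ℝ E] [CompleteSpace E]
    (f : ℝ → E → E) (hf : Continuous (Function.uncurry f)) (m : ℝ → ℝ) (hm : Continuous m)
    (hm0 : ∀ t, 0 ≤ m t) (hf0 : ∀ t, ‖f t 0‖ ≤ m t)
    (hfl : ∀ t x y, ‖f t x - f t y‖ ≤ m t * ‖x - y‖) :
    ∃ V : ℝ → E, Continuous V ∧ ∀ t, 0 ≤ t → V t = ∫ s in (0:ℝ)..t, f s (V s) := by
  set Φ : ℝ → ℝ := fun t => ∫ s in (0:ℝ)..t, 2 * m s with hΦ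
  have hΦd : ∀ t, HasDerivAt Φ (2 * m t) t := fun t =>
    (continuous_const.mul hm).integral_hasStrictDerivAt 0 t |>.hasDerivAt
  have hΦc : Continuous Φ := continuous_iff_continuousAt.2 fun t => (hΦd t).continuousAt
  have hΦ0 : Φ 0 = 0 := by simp [hΦ]
  have hΦnn : ∀ t, 0 ≤ t → 0 ≤ Φ t := fun t ht =>
    intervalIntegral.integral_nonneg ht fun s _ => by have := hm0 s; positivity
  have hint : ∀ t, ∫ s in (0:ℝ)..t, m s * exp (Φ s) = (exp (Φ t) - 1) / 2 := by
    intro t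
    have h := intervalIntegral.integral_eq_sub_of_hasDerivAt (a := 0) (b := t)
      (f := fun t => exp (Φ t) / 2) (f' := fun s => m s * exp (Φ s))
      (fun s _ => by
        have := ((hΦd s).exp).div_const 2
        exact this.congr_deriv (by ring))
      ((hm.mul hΦc.rexp).intervalIntegrable _ _)
    rw [h, hΦ0, Real.exp_zero]; ring
  -- the key estimate
  have key : ∀ (g : ℝ → E) (C : ℝ), 0 ≤ C → (∀ s, 0 ≤ s → ‖g s‖ ≤ C * (m s * exp (Φ s))) →
      ∀ t, 0 ≤ t → ‖exp (-Φ t) • ∫ s in (0:ℝ)..t, g s‖ ≤ C / 2 := by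
    intro g C hC hg t ht
    have h1 : ‖∫ s in (0:ℝ)..t, g s‖ ≤ ∫ s in (0:ℝ)..t, C * (m s * exp (Φ s)) :=
      intervalIntegral.norm_integral_le_of_norm_le ht
        (Filter.Eventually.of_forall fun s hs => hg s hs.1.le)
        ((continuous_const.mul (hm.mul hΦc.rexp)).intervalIntegrable _ _)
    rw [intervalIntegral.integral_const_mul, hint] at h1
    rw [norm_smul, Real.norm_of_nonneg (exp_pos _).le]
    calc exp (-Φ t) * ‖∫ s in (0:ℝ)..t, g s‖
        ≤ exp (-Φ t) * (C * ((exp (Φ t) - 1) / 2)) := by gcongr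
      _ = C / 2 * (exp (-Φ t) * exp (Φ t) - exp (-Φ t)) := by ring
      _ = C / 2 * (1 - exp (-Φ t)) := by rw [← Real.exp_add]; simp
      _ ≤ C / 2 := by nlinarith [exp_pos (-Φ t)]
  have hcont : ∀ u : ℝ → E, Continuous u → Continuous fun s => f s (exp (Φ s) • u s) := by
    intro u hu
    exact hf.comp (continuous_id.prodMk (hΦc.rexp.smul hu))
  have hcontT : ∀ u : ℝ → E, Continuous u → Continuous fun t : ℝ =>
      exp (-Φ (max t 0)) • ∫ s in (0:ℝ)..(max t 0), f s (exp (Φ s) • u s) := by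
    intro u hu
    have h1 : Continuous fun t : ℝ => ∫ s in (0:ℝ)..t, f s (exp (Φ s) • u s) :=
      intervalIntegral.continuous_primitive (fun a b => (hcont u hu).intervalIntegrable a b) 0
    have h2 : Continuous fun t : ℝ => max t 0 := continuous_id.max continuous_const
    exact (hΦc.comp h2).neg.rexp.smul (h1.comp h2)
  have hfb : ∀ t x, ‖f t x‖ ≤ m t * (1 + ‖x‖) := by
    intro t x
    have h1 := hfl t x 0
    have h2 := hf0 t
    have h3 := norm_add_le (f t x - f t 0) (f t 0)
    simp only [sub_add_cancel, sub_zero] at h1 h3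
    nlinarith
  let T : BoundedContinuousFunction ℝ E → BoundedContinuousFunction ℝ E := fun u =>
    BoundedContinuousFunction.ofNormedAddCommGroup
      (fun t : ℝ => exp (-Φ (max t 0)) • ∫ s in (0:ℝ)..(max t 0), f s (exp (Φ s) • u s))
      (hcontT u u.continuous) ((1 + ‖u‖) / 2) (by
        intro t
        apply key _ _ (by positivity) _ _ (le_max_right _ _)
        intro s hs
        have h1 := hfb s (exp (Φ s) • u s)
        rw [norm_smul, Real.norm_of_nonneg (exp_pos _).le] at h1
        have h2 := u.norm_coe_le_norm s
        have h3 : 1 ≤ exp (Φ s) := Real.one_le_exp (hΦnn s hs)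
        calc _ ≤ _ := h1
          _ ≤ m s * (exp (Φ s) + exp (Φ s) * ‖u‖) := by
            have := hm0 s
            gcongr
          _ = _ := by ring)
  have hT : ContractingWith (1/2) T := by
    refine ⟨by rw [← NNReal.coe_lt_coe]; norm_num, LipschitzWith.of_dist_le_mul fun u v => ?_⟩
    rw [BoundedContinuousFunction.dist_le (by positivity)]
    intro t
    change dist (exp (-Φ (max t 0)) • ∫ s in (0:ℝ)..(max t 0), f s (exp (Φ s) • u s))
      (exp (-Φ (max t 0)) • ∫ s in (0:ℝ)..(max t 0), f s (exp (Φ s) • v s)) ≤ _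
    rw [dist_eq_norm, ← smul_sub, ← intervalIntegral.integral_sub
      ((hcont u u.continuous).intervalIntegrable _ _)
      ((hcont v v.continuous).intervalIntegrable _ _)]
    have := key (fun s => f s (exp (Φ s) • u s) - f s (exp (Φ s) • v s)) (dist u v) dist_nonneg
      (fun s hs => by
        have h1 := hfl s (exp (Φ s) • u s) (exp (Φ s) • v s)
        rw [← smul_sub, norm_smul, Real.norm_of_nonneg (exp_pos _).le, ← dist_eq_norm] at h1
        have h2 := BoundedContinuousFunction.dist_coe_le_dist (f := u) (g := v) s
        rw [← dist_eq_norm] at *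
        calc _ ≤ _ := h1
          _ ≤ m s * (exp (Φ s) * dist u v) := by
            have := hm0 s
            gcongr
          _ = _ := by ring) (max t 0) (le_max_right _ _)
    refine this.trans (le_of_eq ?_)
    push_cast; ring
  have hfix := hT.fixedPoint_isFixedPt
  set u := hT.fixedPoint T
  refine ⟨fun t => exp (Φ t) • u t, hΦc.rexp.smul u.continuous, fun t ht => ?_⟩
  have h1 : u t = exp (-Φ (max t 0)) • ∫ s in (0:ℝ)..(max t 0), f s (exp (Φ s) • u s) := by
    conv_lhs => rw [← hfix.eq]
    rfl
  rw [max_eq_left ht] at h1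
  beta_reduce
  conv_lhs => rw [h1]
  rw [smul_smul, ← Real.exp_add]; simp

/-- The integro-differential equation in normal form with continuous coefficients. -/
lemma ide_existsUnique (P Q G e : ℝ → ℝ) (hP : Continuous P) (hQ : Continuous Q)
    (hG : Continuous G) (he : Continuous e) :
    ∃ ρ : ℝ → ℝ, (ContDiff ℝ 1 ρ ∧ ρ 0 = 0 ∧ ∀ t ≥ (0:ℝ), deriv ρ t =
        P t + Q t * (∫ s in (0:ℝ)..t, e s * deriv ρ s) + G t * ρ t) ∧
      ∀ ρ' : ℝ → ℝ, (ContDiff ℝ 1 ρ' ∧ ρ' 0 = 0 ∧ ∀ t ≥ (0:ℝ), deriv ρ' t =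
        P t + Q t * (∫ s in (0:ℝ)..t, e s * deriv ρ' s) + G t * ρ' t) →
        Set.EqOn ρ ρ' (Set.Ici 0) := by
  let φ : ℝ → ℝ × ℝ → ℝ := fun t v => P t + Q t * v.2 + G t * v.1
  let f : ℝ → ℝ × ℝ → ℝ × ℝ := fun t v => (φ t v, e t * φ t v)
  have hφc : Continuous (Function.uncurry φ) := by
    simp only [φ, Function.uncurry_def]; fun_prop
  have hfc : Continuous (Function.uncurry f) :=
    hφc.prodMk ((he.comp continuous_fst).mul hφc)
  let m : ℝ → ℝ := fun t => (1 + |e t|) * (|P t| + |Q t| + |G t|)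
  have hm : Continuous m := by simp only [m]; fun_prop
  have hm0 : ∀ t, 0 ≤ m t := fun t => by positivity
  have hpair : ∀ t x k, |x| ≤ k → ‖((x, e t * x) : ℝ × ℝ)‖ ≤ (1 + |e t|) * k := by
    intro t x k h
    have h0 := abs_nonneg x
    have h1 := abs_nonneg (e t)
    rw [Prod.norm_def, Real.norm_eq_abs, Real.norm_eq_abs, abs_mul]
    apply max_le <;> nlinarith
  have hf0 : ∀ t, ‖f t 0‖ ≤ m t := fun t => hpair t _ _ (by
    simp only [φ, Prod.fst_zero, Prod.snd_zero, mul_zero, add_zero]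
    linarith [abs_nonneg (Q t), abs_nonneg (G t)])
  have hfl : ∀ t x y, ‖f t x - f t y‖ ≤ m t * ‖x - y‖ := by
    intro t x y
    have h1 : f t x - f t y = (φ t x - φ t y, e t * (φ t x - φ t y)) := by
      simp only [f, Prod.mk_sub_mk]; ring_nf
    have h2 : |φ t x - φ t y| ≤ (|P t| + |Q t| + |G t|) * ‖x - y‖ := by
      have h3 : φ t x - φ t y = Q t * (x - y).2 + G t * (x - y).1 := by
        simp only [φ, Prod.fst_sub, Prod.snd_sub]; ring
      have h4 : |(x - y).1| ≤ ‖x - y‖ := norm_fst_le (x - y)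
      have h5 : |(x - y).2| ≤ ‖x - y‖ := norm_snd_le (x - y)
      rw [h3]
      calc _ ≤ |Q t| * |(x - y).2| + |G t| * |(x - y).1| := by
            rw [← abs_mul, ← abs_mul]; exact abs_add_le _ _
        _ ≤ |Q t| * ‖x - y‖ + |G t| * ‖x - y‖ := by gcongr
        _ ≤ _ := by nlinarith [abs_nonneg (P t), norm_nonneg (x - y)]
    rw [h1]
    refine (hpair t _ _ h2).trans (le_of_eq ?_)
    simp only [m]; ring
  -- a solution gives an integral curve
  have curve : ∀ ρ : ℝ → ℝ, (ContDiff ℝ 1 ρ ∧ ρ 0 = 0 ∧ ∀ t ≥ (0:ℝ), deriv ρ t =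
        P t + Q t * (∫ s in (0:ℝ)..t, e s * deriv ρ s) + G t * ρ t) →
      ∀ t ≥ (0:ℝ), HasDerivAt (fun t => (ρ t, ∫ s in (0:ℝ)..t, e s * deriv ρ s))
        (f t (ρ t, ∫ s in (0:ℝ)..t, e s * deriv ρ s)) t := by
    rintro ρ ⟨h1, -, h3⟩ t ht
    have hd : Continuous (deriv ρ) := h1.continuous_deriv le_rfl
    have ha : HasDerivAt ρ (deriv ρ t) t := (h1.differentiable one_ne_zero t).hasDerivAt
    have hb : HasDerivAt (fun t => ∫ s in (0:ℝ)..t, e s * deriv ρ s) (e t * deriv ρ t) t :=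
      ((he.mul hd).integral_hasStrictDerivAt 0 t).hasDerivAt
    have hc := ha.prodMk hb
    rw [h3 t ht] at hc
    exact hc
  obtain ⟨V, hVc, hV⟩ := volterra_exists f hfc m hm hm0 hf0 hfl
  have hφV : Continuous fun s => φ s (V s) := hφc.comp (continuous_id.prodMk hVc)
  let ρ : ℝ → ℝ := fun t => ∫ s in (0:ℝ)..t, φ s (V s)
  have hρd : ∀ t, HasDerivAt ρ (φ t (V t)) t := fun t =>
    (hφV.integral_hasStrictDerivAt 0 t).hasDerivAt
  have hρd' : deriv ρ = fun t => φ t (V t) := funext fun t => (hρd t).deriv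
  have hρ : ContDiff ℝ 1 ρ ∧ ρ 0 = 0 ∧ ∀ t ≥ (0:ℝ), deriv ρ t =
        P t + Q t * (∫ s in (0:ℝ)..t, e s * deriv ρ s) + G t * ρ t := by
    refine ⟨?_, by simp [ρ], fun t ht => ?_⟩
    · rw [contDiff_one_iff_deriv]
      exact ⟨fun t => (hρd t).differentiableAt, by rw [hρd']; exact hφV⟩
    · rw [hρd']
      have hfV : IntervalIntegrable (fun s => f s (V s)) MeasureTheory.volume 0 t :=
        (hfc.comp (continuous_id.prodMk hVc)).intervalIntegrable _ _
      have e1 : (V t).1 = ρ t := by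
        rw [hV t ht]
        exact ((ContinuousLinearMap.fst ℝ ℝ ℝ).intervalIntegral_comp_comm hfV).symm
      have e2 : (V t).2 = ∫ s in (0:ℝ)..t, e s * φ s (V s) := by
        rw [hV t ht]
        exact ((ContinuousLinearMap.snd ℝ ℝ ℝ).intervalIntegral_comp_comm hfV).symm
      change P t + Q t * (V t).2 + G t * (V t).1 = _
      rw [e1, e2]
  refine ⟨ρ, hρ, fun ρ' hρ' t ht => ?_⟩
  have ht : (0:ℝ) ≤ t := ht
  obtain ⟨K, hK⟩ := (isCompact_Icc (a := (0:ℝ)) (b := t)).bddAbove_image hm.continuousOn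
  have c1 := curve ρ hρ
  have c2 := curve ρ' hρ'
  have := ODE_solution_unique_of_mem_Icc_right (v := f) (s := fun _ => Set.univ)
    (K := K.toNNReal) (a := 0) (b := t)
    (fun s hs => (LipschitzWith.of_dist_le_mul fun x y => by
      rw [dist_eq_norm, dist_eq_norm]
      refine (hfl s x y).trans ?_
      gcongr
      exact (hK ⟨s, ⟨hs.1, hs.2.le⟩, rfl⟩).trans (Real.le_coe_toNNReal K)).lipschitzOnWith)
    (fun s hs => (c1 s hs.1).continuousAt.continuousWithinAt)
    (fun s hs => (c1 s hs.1).hasDerivWithinAt) (fun _ _ => trivial)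
    (fun s hs => (c2 s hs.1).continuousAt.continuousWithinAt)
    (fun s hs => (c2 s hs.1).hasDerivWithinAt) (fun _ _ => trivial)
    (by simp [hρ.2.1, hρ'.2.1])
  exact congrArg Prod.fst (this ⟨ht, le_rfl⟩)

/-- Global existence and uniqueness on `[0,∞)` of the solution `ρ` (with `ρ(0) = 0`) of the
integro-differential equation characterising the equilibrium random stopping distribution. -/
theorem stmt12 (a b c uL ΔH ΔL L₀ : ℝ) (ha : 0 < a) (hab : a < b) (hc : 0 < c)
    (huL : uL < 0) (hΔH : 0 < ΔH) (hΔL : 0 < ΔL) (hL₀ : 0 < L₀)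
    (L : ℝ → ℝ) (hL : ∀ t : ℝ, L t = L₀ * Real.exp ((b - a) * t)) :
    ∃ ρ : ℝ → ℝ,
      (ContDiff ℝ 1 ρ ∧ ρ 0 = 0 ∧
        ∀ t ≥ (0:ℝ),
          deriv ρ t =
            (b * (-uL) - c - L t * c
              + b * ΔL * (∫ s in (0:ℝ)..t, Real.exp (-b * s) * deriv ρ s)
              - L t * ΔH * a * Real.exp (-a * t) * (1 - ρ t)) /
            (L t * ΔH * Real.exp (-a * t) + ΔL * Real.exp (-b * t))) ∧
      ∀ ρ' : ℝ → ℝ,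
        (ContDiff ℝ 1 ρ' ∧ ρ' 0 = 0 ∧
          ∀ t ≥ (0:ℝ),
            deriv ρ' t =
              (b * (-uL) - c - L t * c
                + b * ΔL * (∫ s in (0:ℝ)..t, Real.exp (-b * s) * deriv ρ' s)
                - L t * ΔH * a * Real.exp (-a * t) * (1 - ρ' t)) /
              (L t * ΔH * Real.exp (-a * t) + ΔL * Real.exp (-b * t))) →
        Set.EqOn ρ ρ' (Set.Ici 0) := by
  have hLc : Continuous L := by
    rw [show L = fun t => L₀ * Real.exp ((b - a) * t) from funext hL]; fun_prop
  have hLp : ∀ t, 0 < L t := fun t => by rw [hL]; positivity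
  let D : ℝ → ℝ := fun t => L t * ΔH * Real.exp (-a * t) + ΔL * Real.exp (-b * t)
  have hD : ∀ t, D t ≠ 0 := fun t => by
    have := hLp t
    have : 0 < D t := by positivity
    exact this.ne'
  have hDc : Continuous D := by simp only [D]; fun_prop
  have main := ide_existsUnique
    (fun t => (b * (-uL) - c - L t * c - L t * ΔH * a * Real.exp (-a * t)) / D t)
    (fun t => b * ΔL / D t) (fun t => L t * ΔH * a * Real.exp (-a * t) / D t)
    (fun t => Real.exp (-b * t))
    (Continuous.div (by fun_prop) hDc hD) (Continuous.div (by fun_prop) hDc hD)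
    (Continuous.div (by fun_prop) hDc hD) (by fun_prop)
  have hrw : ∀ t I y : ℝ, (b * (-uL) - c - L t * c - L t * ΔH * a * Real.exp (-a * t)) / D t
      + b * ΔL / D t * I + L t * ΔH * a * Real.exp (-a * t) / D t * y
      = (b * (-uL) - c - L t * c + b * ΔL * I - L t * ΔH * a * Real.exp (-a * t) * (1 - y)) /
        (L t * ΔH * Real.exp (-a * t) + ΔL * Real.exp (-b * t)) := by
    intro t I y
    change _ = _ / D t
    ring
  simp only [hrw] at main
  exact main
end

section
/- Let b > a > 0, c > 0, u_L < 0, ▵̄_H > 0, and suppose −b·u_L − c > 0 and 0 < L₀ < (−b·u_L − c)/(c + a·▵̄_H). Then the set { t > 0 : L₀·e^{(b−a)t} = (−b·u_L − c)/(c + a·e^{−at}·▵̄_H) } is nonempty and has a minimum T_r, and T_r > 0. -/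
open Real Set Filter Topology

/-- Existence of the latest admissible randomisation start time `T_r`: the set of positive
solutions of `L₀e^{(b−a)t} = (−bu_L − c)/(c + a e^{−at}▵̄_H)` is nonempty and has a
strictly positive minimum. -/
theorem stmt14 (a b c uL ΔH L₀ : ℝ) (ha : 0 < a) (hab : a < b) (hc : 0 < c)
    (huL : uL < 0) (hΔH : 0 < ΔH) (hnum : 0 < -b * uL - c)
    (hL₀ : 0 < L₀) (hL₀' : L₀ < (-b * uL - c) / (c + a * ΔH)) :
    ∃ Tr : ℝ,
      IsLeast {t : ℝ | 0 < t ∧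
        L₀ * Real.exp ((b - a) * t)
          = (-b * uL - c) / (c + a * Real.exp (-a * t) * ΔH)} Tr ∧
      0 < Tr := by
  have hden : ∀ t : ℝ, 0 < c + a * Real.exp (-a * t) * ΔH := fun t => by positivity
  set N := -b * uL - c with hN
  have hba : 0 < b - a := sub_pos.mpr hab
  let g : ℝ → ℝ := fun t => L₀ * Real.exp ((b - a) * t) - N / (c + a * Real.exp (-a * t) * ΔH)
  have hg : Continuous g := by
    refine Continuous.sub (by fun_prop) ?_
    exact Continuous.div (by fun_prop) (by fun_prop) (fun t => (hden t).ne')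
  have hg0 : g 0 < 0 := by
    simp only [g, mul_zero, Real.exp_zero, mul_one]
    linarith
  have hM : ∃ M : ℝ, 0 ≤ M ∧ 0 ≤ g M := by
    refine ⟨N / (c * L₀ * (b - a)), by positivity, ?_⟩
    set M := N / (c * L₀ * (b - a)) with hMdef
    have h1 : N / (c + a * Real.exp (-a * M) * ΔH) ≤ N / c := by
      apply div_le_div_of_nonneg_left hnum.le hc
      have : 0 < a * Real.exp (-a * M) * ΔH := by positivity
      linarith
    have h2 := mul_le_mul_of_nonneg_left (Real.add_one_le_exp ((b - a) * M)) hL₀.le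
    have h3 : L₀ * ((b - a) * M) = N / c := by
      rw [hMdef]
      field_simp
    have h4 : N / c ≤ L₀ * Real.exp ((b - a) * M) := by
      rw [mul_add, h3] at h2
      linarith
    simp only [g]
    linarith
  obtain ⟨M, hM0, hgM⟩ := hM
  let S : Set ℝ := Ici 0 ∩ g ⁻¹' {0}
  have hS : IsClosed S := isClosed_Ici.inter (isClosed_singleton.preimage hg)
  have hne : S.Nonempty := by
    obtain ⟨t, ht, hgt⟩ := intermediate_value_Icc hM0 hg.continuousOn ⟨hg0.le, hgM⟩
    exact ⟨t, ht.1, hgt⟩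
  have hbdd : BddBelow S := ⟨0, fun t ht => ht.1⟩
  have hleast := hS.isLeast_csInf hne hbdd
  obtain ⟨hT0, hTg⟩ := hleast.1
  have hTg' : g (sInf S) = 0 := hTg
  have hTpos : 0 < sInf S := by
    rcases (show 0 ≤ sInf S from hT0).lt_or_eq with h | h
    · exact h
    · rw [← h] at hTg'
      exact absurd hTg' hg0.ne
  exact ⟨sInf S, ⟨⟨hTpos, sub_eq_zero.mp hTg'⟩,
    fun t ht => hleast.2 ⟨ht.1.le, sub_eq_zero.mpr ht.2⟩⟩, hTpos⟩
end

section
/- Let b > a > 0, u_L < 0, ▵̄_H > 0, u_H − ▵̄_H > 0, and 0 < L₀ < (−u_L)/u_H. Then the set { t > 0 : L₀·e^{(b−a)t} = (−u_L)/(u_H − (1 − e^{−at})·▵̄_H) } is nonempty and has a minimum T_l, and T_l > 0. -/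
open Real Set Filter Topology

/-- Existence of the earliest admissible randomisation start time `T_l`: the set of positive
solutions of `L₀e^{(b−a)t} = (−u_L)/(u_H − (1 − e^{−at})▵̄_H)` is nonempty and has a
strictly positive minimum. -/
theorem stmt15 (a b uH uL ΔH L₀ : ℝ) (ha : 0 < a) (hab : a < b)
    (huL : uL < 0) (hΔH : 0 < ΔH) (hH : 0 < uH - ΔH)
    (hL₀ : 0 < L₀) (hL₀' : L₀ < -uL / uH) :
    ∃ Tl : ℝ,
      IsLeast {t : ℝ | 0 < t ∧
        L₀ * Real.exp ((b - a) * t)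
          = -uL / (uH - (1 - Real.exp (-a * t)) * ΔH)} Tl ∧
      0 < Tl := by
  have hD : ∀ t : ℝ, uH - ΔH < uH - (1 - Real.exp (-a * t)) * ΔH := fun t => by
    nlinarith [mul_pos (Real.exp_pos (-a * t)) hΔH]
  have hba : 0 < b - a := sub_pos.2 hab
  have huH : 0 < uH := by linarith
  obtain ⟨g, hg⟩ : ∃ g : ℝ → ℝ, g = fun t => L₀ * Real.exp ((b - a) * t) *
    (uH - (1 - Real.exp (-a * t)) * ΔH) := ⟨_, rfl⟩
  have hgc : Continuous g := by rw [hg]; fun_prop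
  have hiff : ∀ t : ℝ, (L₀ * Real.exp ((b - a) * t)
          = -uL / (uH - (1 - Real.exp (-a * t)) * ΔH)) ↔ g t = -uL := fun t => by
    rw [eq_div_iff (hH.trans (hD t)).ne', hg]
  simp only [hiff]
  have h0 : g 0 < -uL := by
    rw [lt_div_iff₀ huH] at hL₀'
    simpa [hg] using hL₀'
  obtain ⟨T, hT⟩ : ∃ T : ℝ, T = -uL / (L₀ * (uH - ΔH) * (b - a)) := ⟨_, rfl⟩
  have hTpos : 0 < T := by
    rw [hT]; exact div_pos (by linarith) (by positivity)
  have hgT : -uL ≤ g T := by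
    have h1 : T * (L₀ * (uH - ΔH) * (b - a)) = -uL := by
      rw [hT]; exact div_mul_cancel₀ _ (by positivity)
    have h2 : (b - a) * T ≤ Real.exp ((b - a) * T) := by
      linarith [Real.add_one_le_exp ((b - a) * T)]
    calc -uL = L₀ * ((b - a) * T) * (uH - ΔH) := by rw [← h1]; ring
      _ ≤ L₀ * Real.exp ((b - a) * T) * (uH - ΔH) := by gcongr
      _ ≤ L₀ * Real.exp ((b - a) * T) * (uH - (1 - Real.exp (-a * T)) * ΔH) :=
        mul_le_mul_of_nonneg_left (hD T).le (by positivity)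
      _ = g T := by rw [hg]
  obtain ⟨s, hs, hgs⟩ := intermediate_value_Icc hTpos.le hgc.continuousOn ⟨h0.le, hgT⟩
  have hK : IsCompact (Icc 0 T ∩ g ⁻¹' {-uL}) :=
    isCompact_Icc.inter_right (isClosed_singleton.preimage hgc)
  obtain ⟨m, ⟨hm, hgm⟩, hmin⟩ := hK.exists_isLeast ⟨s, hs, hgs⟩
  have hgm' : g m = -uL := hgm
  have hmpos : 0 < m := by
    rcases hm.1.eq_or_lt with h | h
    · rw [← h] at hgm'; linarith
    · exact h
  refine ⟨m, ⟨⟨hmpos, hgm'⟩, ?_⟩, hmpos⟩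
  rintro t ⟨ht, hgt⟩
  rcases le_total t T with h | h
  · exact hmin ⟨⟨ht.le, h⟩, hgt⟩
  · exact hm.2.trans h
end

section
/- Let u_L < 0, a > 0, ▵̄_H > 0, b > 0, and 0 < c < −b·u_L. For each integer N ≥ 2 define L̃_N = (−b·u_L − c)/((N−1)·a·▵̄_H + c) and p̃_N = L̃_N/(1 + L̃_N). Then N ↦ p̃_N is strictly decreasing on {2, 3, …} and p̃_N → 0 as N → ∞. Moreover, if for a fixed D > 0 the prize gap is scaled as ▵̄_H = D/(N−1), then L̃_N = (−b·u_L − c)/(a·D + c) is independent of N, so p̃_N stays constant and strictly positive as N → ∞. -/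
open Real Set Filter Topology

/-- In the N-player extension, the cutoff `p̃_N` is strictly decreasing in the number of
players and vanishes as `N → ∞`; if the prize gap is scaled as `▵̄_H = D/(N−1)` the cutoff
likelihood ratio is independent of `N` and the cutoff belief stays strictly positive. -/
theorem stmt19 (a b c uL ΔH : ℝ) (huL : uL < 0) (ha : 0 < a) (hΔH : 0 < ΔH)
    (hb : 0 < b) (hc : 0 < c) (hc' : c < -b * uL)
    (Lt pt : ℕ → ℝ)
    (hLt : ∀ N : ℕ, Lt N = (-b * uL - c) / (((N : ℝ) - 1) * a * ΔH + c))
    (hpt : ∀ N : ℕ, pt N = Lt N / (1 + Lt N)) :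
    StrictAntiOn pt (Set.Ici 2) ∧
    Filter.Tendsto pt Filter.atTop (nhds 0) ∧
    ∀ D : ℝ, 0 < D → ∀ N : ℕ, 2 ≤ N →
      (-b * uL - c) / (((N : ℝ) - 1) * a * (D / ((N : ℝ) - 1)) + c)
        = (-b * uL - c) / (a * D + c) ∧
      0 < ((-b * uL - c) / (a * D + c)) / (1 + (-b * uL - c) / (a * D + c)) := by
  have hK : 0 < -b * uL - c := by linarith
  have hden : ∀ N : ℕ, 2 ≤ N → 0 < ((N : ℝ) - 1) * a * ΔH + c := by
    intro N hN
    have h2 : (2 : ℝ) ≤ N := by exact_mod_cast hN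
    have h1 : (0 : ℝ) < (N : ℝ) - 1 := by linarith
    positivity
  refine ⟨?_, ?_, ?_⟩
  · intro M hM N hN hMN
    have dM := hden M hM
    have dN := hden N hN
    have hlt : (M : ℝ) < N := by exact_mod_cast hMN
    have haD : 0 < a * ΔH := mul_pos ha hΔH
    have hL : Lt N < Lt M := by
      rw [hLt, hLt]
      apply div_lt_div_of_pos_left hK dM
      nlinarith [mul_lt_mul_of_pos_right hlt haD]
    have pN : 0 < Lt N := by rw [hLt]; exact div_pos hK dN
    have pM : 0 < Lt M := pN.trans hL
    rw [hpt, hpt, div_lt_div_iff₀ (by linarith) (by linarith)]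
    nlinarith
  · have hT : Tendsto (fun N : ℕ => ((N : ℝ) - 1) * a * ΔH + c) atTop atTop := by
      apply tendsto_atTop_add_const_right
      apply Tendsto.atTop_mul_const hΔH
      apply Tendsto.atTop_mul_const ha
      exact tendsto_atTop_add_const_right _ (-1) tendsto_natCast_atTop_atTop
    have hL : Tendsto Lt atTop (𝓝 0) := by
      rw [funext hLt]
      exact Tendsto.const_div_atTop hT _
    rw [funext hpt]
    have h := hL.div (hL.const_add 1) (by norm_num)
    have e : (0 : ℝ) / (1 + 0) = 0 := by norm_num
    rw [e] at h
    exact h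
  · intro D hD N hN
    have h2 : (2 : ℝ) ≤ N := by exact_mod_cast hN
    have h1 : (N : ℝ) - 1 ≠ 0 := by linarith
    refine ⟨?_, by positivity⟩
    have e : ((N : ℝ) - 1) * a * (D / ((N : ℝ) - 1)) = a * D := by field_simp
    rw [e]
end
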